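/- Suppose p ≥ p_S and γ > 1. Then the solution u(·,γ) exists and is positive on all of [0,∞); it has a first positive critical point s₁ such that u'(s,γ) < 0 for all s ∈ (0,s₁), 0 < u(s₁,γ) < 1, and u(s,γ) ≥ u(s₁,γ) for all s ≥ s₁; and the function s ↦ u(s,γ) − 1 has infinitely many zeros in (0,∞). In particular u(·,γ) has infinitely many positive critical points. -/

import Mathlib

open Real Set Filter Topology MeasureTheory

noncomputable section

/-- The nonlinearity `f(u) = -u + u^p`. -/
def fNL (p u : ℝ) : ℝ := -u + u ^ p

/-- The Sobolev critical exponent `p_S = (N+2)/(N-2)`. -/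
def pSob (N : ℕ) : ℝ := ((N : ℝ) + 2) / ((N : ℝ) - 2)

/-- `θ = 2/(p-1)`. -/
def thetaP (p : ℝ) : ℝ := 2 / (p - 1)

/-- `A = (θ(N-2-θ))^{1/(p-1)}`. -/
def Aconst (N : ℕ) (p : ℝ) : ℝ :=
  (thetaP p * ((N : ℝ) - 2 - thetaP p)) ^ (1 / (p - 1))

/-- `m = (θ(N-2-θ))^{-1/2}`. -/
def mConst (N : ℕ) (p : ℝ) : ℝ :=
  (thetaP p * ((N : ℝ) - 2 - thetaP p)) ^ (-(1 / 2) : ℝ)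

/-- `α = m(N-2-2θ)`. -/
def alphaConst (N : ℕ) (p : ℝ) : ℝ :=
  mConst N p * ((N : ℝ) - 2 - 2 * thetaP p)

/-- The condition `p < p_JL`, where `p_JL = 1 + 4/(N-4-2√(N-1))` for `N ≥ 11` and
`p_JL = ∞` for `N ≤ 10`. -/
def pJLcond (N : ℕ) (p : ℝ) : Prop :=
  11 ≤ N → p < 1 + 4 / ((N : ℝ) - 4 - 2 * Real.sqrt ((N : ℝ) - 1))

/-- `y` is a C² solution of `y'' + α y' - y + y^p - m² e^{2mt} y = 0` on `(-∞, T]`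
with `y → 1` as `t → -∞`; `y'`, `y''` are its first and second derivatives. -/
def IsSingODEOn (N : ℕ) (p T : ℝ) (y y' y'' : ℝ → ℝ) : Prop :=
  (∀ t ∈ Iic T, HasDerivWithinAt y (y' t) (Iic T) t) ∧
  (∀ t ∈ Iic T, HasDerivWithinAt y' (y'' t) (Iic T) t) ∧
  ContinuousOn y'' (Iic T) ∧
  (∀ t ∈ Iic T, y'' t + alphaConst N p * y' t - y t + y t ^ p
      - (mConst N p) ^ 2 * Real.exp (2 * mConst N p * t) * y t = 0) ∧
  Tendsto y atBot (𝓝 1)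

/-- `y` is a C² solution of `y'' + α y' - y + y^p - m² e^{2mt} y = 0` on all of `ℝ`
with `y → 1` as `t → -∞`. -/
def IsEntireSingODE (N : ℕ) (p : ℝ) (y y' y'' : ℝ → ℝ) : Prop :=
  (∀ t : ℝ, HasDerivAt y (y' t) t) ∧
  (∀ t : ℝ, HasDerivAt y' (y'' t) t) ∧
  Continuous y'' ∧
  (∀ t : ℝ, y'' t + alphaConst N p * y' t - y t + y t ^ p
      - (mConst N p) ^ 2 * Real.exp (2 * mConst N p * t) * y t = 0) ∧
  Tendsto y atBot (𝓝 1)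

/-- The singular solution `u*(s) = A s^{-θ} y*(m⁻¹ log s)` built from `y*`. -/
def ustar (N : ℕ) (p : ℝ) (y : ℝ → ℝ) (s : ℝ) : ℝ :=
  Aconst N p * s ^ (-(thetaP p)) * y (Real.log s / mConst N p)

/-- `u` is a C² solution on `[0,∞)` of the IVP `u'' + ((N-1)/s)u' + f(u) = 0`,
`u(0) = γ`, `u'(0) = 0`, with nonlinearity `f(u) = -u + u^p`. -/
def IsIVPSol (N : ℕ) (p γ : ℝ) (u u' u'' : ℝ → ℝ) : Prop :=
  (∀ s ∈ Ici (0:ℝ), HasDerivWithinAt u (u' s) (Ici 0) s) ∧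
  (∀ s ∈ Ici (0:ℝ), HasDerivWithinAt u' (u'' s) (Ici 0) s) ∧
  ContinuousOn u'' (Ici 0) ∧
  u 0 = γ ∧ u' 0 = 0 ∧
  (∀ s > (0:ℝ), u'' s + ((N : ℝ) - 1) / s * u' s + fNL p (u s) = 0)

/-- `u` is a C² solution on `[0,∞)` of the IVP `u'' + ((N-1)/ρ)u' + u^p = 0`,
`u(0) = γ`, `u'(0) = 0`. -/
def IsBarSol (N : ℕ) (p γ : ℝ) (u u' u'' : ℝ → ℝ) : Prop :=
  (∀ ρ ∈ Ici (0:ℝ), HasDerivWithinAt u (u' ρ) (Ici 0) ρ) ∧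
  (∀ ρ ∈ Ici (0:ℝ), HasDerivWithinAt u' (u'' ρ) (Ici 0) ρ) ∧
  ContinuousOn u'' (Ici 0) ∧
  u 0 = γ ∧ u' 0 = 0 ∧
  (∀ ρ > (0:ℝ), u'' ρ + ((N : ℝ) - 1) / ρ * u' ρ + u ρ ^ p = 0)

/-- `s` is the `(k+1)`-th positive critical point of a function whose derivative is `u'`:
`s` is a positive critical point having exactly `k` positive critical points below it. -/
def IsNthCritPt (u' : ℝ → ℝ) (k : ℕ) (s : ℝ) : Prop :=
  0 < s ∧ u' s = 0 ∧ {x : ℝ | 0 < x ∧ x < s ∧ u' x = 0}.encard = (k : ℕ∞)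

/-- `U` is a positive C² radial solution of the Neumann problem
`U'' + ((N-1)/r)U' + λ f(U) = 0` on `(0,1)`, `U'(0) = U'(1) = 0`, `U > 0` on `[0,1]`. -/
def NeumannSol (N : ℕ) (p lam : ℝ) (U U' U'' : ℝ → ℝ) : Prop :=
  (∀ r ∈ Icc (0:ℝ) 1, HasDerivWithinAt U (U' r) (Icc 0 1) r) ∧
  (∀ r ∈ Icc (0:ℝ) 1, HasDerivWithinAt U' (U'' r) (Icc 0 1) r) ∧
  ContinuousOn U'' (Icc 0 1) ∧
  (∀ r ∈ Ioo (0:ℝ) 1, U'' r + ((N : ℝ) - 1) / r * U' r + lam * fNL p (U r) = 0) ∧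
  U' 0 = 0 ∧ U' 1 = 0 ∧ (∀ r ∈ Icc (0:ℝ) 1, 0 < U r)

/-- `(lam, U)` is a singular solution of the Neumann problem whose graph meets `1`
exactly `n` times: `U` is C² on `(0,1)`, continuous on `(0,1]`, `U'(1) = 0`, it solves
`U'' + ((N-1)/r)U' + λ f(U) = 0` on `(0,1)`, satisfies the asymptotics
`U(r) = A(√λ r)^{-θ}(1+o(1))` as `r ↓ 0` (i.e. `r^θ U(r) → A λ^{-θ/2}`),
`U - 1` has exactly `n` zeros in `(0,1]`, and `U > 0` on `(0,1]`. -/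
def SingBVPSol (N : ℕ) (p lam : ℝ) (n : ℕ) (U U' U'' : ℝ → ℝ) : Prop :=
  (∀ r ∈ Ioc (0:ℝ) 1, HasDerivWithinAt U (U' r) (Ioc 0 1) r) ∧
  (∀ r ∈ Ioo (0:ℝ) 1, HasDerivAt U' (U'' r) r) ∧
  ContinuousOn U (Ioc 0 1) ∧
  ContinuousOn U'' (Ioo 0 1) ∧
  (∀ r ∈ Ioo (0:ℝ) 1, U'' r + ((N : ℝ) - 1) / r * U' r + lam * fNL p (U r) = 0) ∧
  U' 1 = 0 ∧
  Tendsto (fun r => r ^ thetaP p * U r) (𝓝[>] (0:ℝ))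
    (𝓝 (Aconst N p * lam ^ (-(thetaP p) / 2))) ∧
  {r ∈ Ioc (0:ℝ) 1 | U r = 1}.encard = (n : ℕ∞) ∧
  (∀ r ∈ Ioc (0:ℝ) 1, 0 < U r)

/-- The weighted average `∫₀¹ σⁿ h(rσ) dσ`. -/
def radialAverage (n : ℕ) (h : ℝ → ℝ) (r : ℝ) : ℝ := ∫ σ in (0:ℝ)..1, σ ^ n * h (r * σ)

/-- The solution operator `s² ∫₀¹ τ (∫₀¹ σⁿ h(sτσ) dσ) dτ` of `w'' + (n/s) w' = h`,
`w(0) = w'(0) = 0`. -/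
def radialSolve (n : ℕ) (h : ℝ → ℝ) (s : ℝ) : ℝ :=
  s ^ 2 * ∫ τ in (0:ℝ)..1, τ * radialAverage n h (s * τ)

lemma continuous_radialAverage {n : ℕ} {h : ℝ → ℝ} (hh : Continuous h) :
    Continuous (radialAverage n h) := by
  unfold radialAverage
  exact intervalIntegral.continuous_parametric_intervalIntegral_of_continuous' (by fun_prop) _ _

lemma continuous_radialSolve {n : ℕ} {h : ℝ → ℝ} (hh : Continuous h) :
    Continuous (radialSolve n h) := by
  have := continuous_radialAverage (n := n) hh
  unfold radialSolve
  exact (continuous_id.pow 2).mul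
    (intervalIntegral.continuous_parametric_intervalIntegral_of_continuous' (by fun_prop) _ _)

lemma radialAverage_sub {n : ℕ} {h k : ℝ → ℝ} (hh : Continuous h) (hk : Continuous k) (r : ℝ) :
    radialAverage n (fun t => h t - k t) r = radialAverage n h r - radialAverage n k r := by
  unfold radialAverage
  rw [← intervalIntegral.integral_sub
    (Continuous.intervalIntegrable (by fun_prop) _ _)
    (Continuous.intervalIntegrable (by fun_prop) _ _)]
  simp only [mul_sub]

lemma radialSolve_sub {n : ℕ} {h k : ℝ → ℝ} (hh : Continuous h) (hk : Continuous k) (s : ℝ) :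
    radialSolve n (fun t => h t - k t) s = radialSolve n h s - radialSolve n k s := by
  have h1 := continuous_radialAverage (n := n) hh
  have h2 := continuous_radialAverage (n := n) hk
  unfold radialSolve
  rw [← mul_sub, ← intervalIntegral.integral_sub
    (Continuous.intervalIntegrable (by fun_prop) _ _)
    (Continuous.intervalIntegrable (by fun_prop) _ _)]
  simp only [radialAverage_sub hh hk, mul_sub]

lemma abs_radialAverage_le {n : ℕ} {h : ℝ → ℝ} {C l : ℝ} (hC : 0 ≤ C) (hl : 0 ≤ l)
    (hb : ∀ t, |h t| ≤ C * exp (l * t ^ 2)) (r : ℝ) :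
    |radialAverage n h r| ≤ C * exp (l * r ^ 2) := by
  have key : ‖∫ σ in (0:ℝ)..1, σ ^ n * h (r * σ)‖ ≤ C * exp (l * r ^ 2) * |1 - 0| := by
    apply intervalIntegral.norm_integral_le_of_norm_le_const
    intro σ hσ
    rw [uIoc_of_le zero_le_one] at hσ
    rw [norm_mul, Real.norm_eq_abs, Real.norm_eq_abs, abs_of_nonneg (pow_nonneg hσ.1.le n)]
    have h1 : σ ^ n ≤ 1 := pow_le_one₀ hσ.1.le hσ.2
    have h2 : exp (l * (r * σ) ^ 2) ≤ exp (l * r ^ 2) := by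
      apply exp_le_exp.2
      apply mul_le_mul_of_nonneg_left _ hl
      rw [mul_pow]
      exact mul_le_of_le_one_right (sq_nonneg r) (pow_le_one₀ hσ.1.le hσ.2)
    calc σ ^ n * |h (r * σ)| ≤ 1 * |h (r * σ)| := by gcongr
      _ ≤ C * exp (l * (r * σ) ^ 2) := by rw [one_mul]; exact hb _
      _ ≤ _ := by gcongr
  simpa [radialAverage] using key

lemma abs_radialSolve_le {n : ℕ} {h : ℝ → ℝ} {C l : ℝ} (hC : 0 ≤ C)
    (hl : 0 < l) (hb : ∀ t, |h t| ≤ C * exp (l * t ^ 2)) (s : ℝ) :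
    |radialSolve n h s| ≤ C / (2 * l) * exp (l * s ^ 2) := by
  have hint : ∫ τ in (0:ℝ)..1, C * (2 * l * s ^ 2 * τ * exp (l * (s * τ) ^ 2))
      = C * (exp (l * s ^ 2) - 1) := by
    rw [intervalIntegral.integral_const_mul]
    congr 1
    have hd : ∀ τ ∈ uIcc (0:ℝ) 1, HasDerivAt (fun τ => exp (l * (s * τ) ^ 2))
        (2 * l * s ^ 2 * τ * exp (l * (s * τ) ^ 2)) τ := by
      intro τ _
      have := ((((hasDerivAt_id τ).const_mul s).pow 2).const_mul l).exp
      refine this.congr_deriv ?_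
      simp
      ring
    rw [intervalIntegral.integral_eq_sub_of_hasDerivAt hd
      (Continuous.intervalIntegrable (by fun_prop) _ _)]
    simp
  have hle : ‖∫ τ in (0:ℝ)..1, 2 * l * s ^ 2 * (τ * radialAverage n h (s * τ))‖ ≤
      ∫ τ in (0:ℝ)..1, C * (2 * l * s ^ 2 * τ * exp (l * (s * τ) ^ 2)) := by
    apply intervalIntegral.norm_integral_le_of_norm_le zero_le_one
    · filter_upwards with τ hτ
      have h0 : 0 ≤ 2 * l * s ^ 2 * τ := by have := hτ.1.le; positivity
      rw [← mul_assoc, norm_mul, Real.norm_eq_abs, Real.norm_eq_abs, abs_of_nonneg h0]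
      calc _ ≤ 2 * l * s ^ 2 * τ * (C * exp (l * (s * τ) ^ 2)) :=
            mul_le_mul_of_nonneg_left (abs_radialAverage_le hC hl.le hb _) h0
        _ = _ := by ring
    · exact Continuous.intervalIntegrable (by fun_prop) _ _
  rw [hint, intervalIntegral.integral_const_mul, mul_assoc, ← radialSolve, norm_mul,
    Real.norm_eq_abs, Real.norm_eq_abs, abs_of_pos (by positivity)] at hle
  rw [div_mul_eq_mul_div, le_div_iff₀ (by positivity)]
  nlinarith

lemma radialSolve_eq_integral (n : ℕ) (h : ℝ → ℝ) (s : ℝ) :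
    radialSolve n h s = ∫ r in (0:ℝ)..s, r * radialAverage n h r := by
  have := intervalIntegral.mul_integral_comp_mul_left (a := 0) (b := 1)
    (f := fun r => r * radialAverage n h r) s
  rw [mul_zero, mul_one] at this
  rw [← this, radialSolve, sq, mul_assoc, ← intervalIntegral.integral_const_mul]
  simp only [mul_assoc]

lemma pow_mul_radialAverage (n : ℕ) (h : ℝ → ℝ) (s : ℝ) :
    s ^ (n + 1) * radialAverage n h s = ∫ t in (0:ℝ)..s, t ^ n * h t := by
  have := intervalIntegral.mul_integral_comp_mul_left (a := 0) (b := 1)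
    (f := fun t => t ^ n * h t) s
  rw [mul_zero, mul_one] at this
  rw [← this, radialAverage, pow_succ', mul_assoc, ← intervalIntegral.integral_const_mul]
  simp only [mul_pow, mul_assoc]

lemma hasDerivAt_radialSolve {n : ℕ} {h : ℝ → ℝ} (hh : Continuous h) (s : ℝ) :
    HasDerivAt (radialSolve n h) (s * radialAverage n h s) s := by
  have := continuous_radialAverage (n := n) hh
  rw [funext (radialSolve_eq_integral n h)]
  exact intervalIntegral.integral_hasDerivAt_right
    (Continuous.intervalIntegrable (by fun_prop) _ _)
    (Continuous.stronglyMeasurableAtFilter (by fun_prop) _ _) (by fun_prop)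

lemma hasDerivAt_mul_radialAverage {n : ℕ} {h : ℝ → ℝ} (hh : Continuous h) (s : ℝ) :
    HasDerivAt (fun s => s * radialAverage n h s) (h s - n * radialAverage n h s) s := by
  have hc := continuous_radialAverage (n := n) hh
  rcases eq_or_ne s 0 with rfl | hs
  · have h0 : h 0 - n * radialAverage n h 0 = radialAverage n h 0 := by
      have : radialAverage n h 0 = h 0 / (n + 1) := by
        simp [radialAverage, intervalIntegral.integral_mul_const, div_eq_inv_mul]
      rw [this]
      field_simp
      ring
    rw [h0, hasDerivAt_iff_tendsto_slope]
    refine (hc.tendsto 0 |>.mono_left nhdsWithin_le_nhds).congr' ?_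
    filter_upwards [self_mem_nhdsWithin] with t ht
    have : t ≠ 0 := ht
    simp [slope_def_field, this]
  · have h1 : HasDerivAt (fun s => ∫ t in (0:ℝ)..s, t ^ n * h t) (s ^ n * h s) s :=
      intervalIntegral.integral_hasDerivAt_right
        (Continuous.intervalIntegrable (by fun_prop) _ _)
        (Continuous.stronglyMeasurableAtFilter (by fun_prop) _ _) (by fun_prop)
    have h2 := h1.div (hasDerivAt_pow n s) (pow_ne_zero n hs)
    have h3 : (fun s => s * radialAverage n h s) =ᶠ[𝓝 s]
        (fun s => ∫ t in (0:ℝ)..s, t ^ n * h t) / fun s => s ^ n := by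
      filter_upwards [isOpen_ne.mem_nhds hs] with t ht
      have : t ≠ 0 := ht
      rw [Pi.div_apply, ← pow_mul_radialAverage]
      field_simp
      ring
    refine (h2.congr_of_eventuallyEq h3).congr_deriv ?_
    rw [← pow_mul_radialAverage]
    rcases n with _ | n
    · simp
    · simp
      field_simp
      ring

/-- Global existence for the radial initial value problem with a bounded Lipschitz nonlinearity. -/
theorem exists_radial_solution (n : ℕ) {g : ℝ → ℝ} {L : NNReal} (hg : LipschitzWith L g)
    {M : ℝ} (hM : ∀ x, |g x| ≤ M) (γ : ℝ) :
    ∃ u u' u'' : ℝ → ℝ, (∀ s, HasDerivAt u (u' s) s) ∧ (∀ s, HasDerivAt u' (u'' s) s) ∧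
      Continuous u'' ∧ u 0 = γ ∧ u' 0 = 0 ∧
      ∀ s > 0, u'' s + n / s * u' s + g (u s) = 0 := by
  have hM0 : 0 ≤ M := (abs_nonneg _).trans (hM 0)
  have hgc := hg.continuous
  set l : ℝ := L + 1 with hl_def
  have hl : 0 < l := by positivity
  let H : BoundedContinuousFunction ℝ ℝ → ℝ → ℝ := fun w t => g (γ - exp (l * t ^ 2) * w t)
  have hH : ∀ w, Continuous (H w) := fun w => by
    have := w.continuous
    fun_prop
  let T : BoundedContinuousFunction ℝ ℝ → BoundedContinuousFunction ℝ ℝ := fun w =>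
    BoundedContinuousFunction.ofNormedAddCommGroup
      (fun s => exp (-(l * s ^ 2)) * radialSolve n (H w) s)
      (by have := continuous_radialSolve (n := n) (hH w); fun_prop) (M / (2 * l)) (by
        intro s
        have hb : ∀ t, |H w t| ≤ M * exp (l * t ^ 2) := fun t =>
          (hM _).trans (le_mul_of_one_le_right hM0 (one_le_exp (by positivity)))
        rw [norm_mul, Real.norm_eq_abs, Real.norm_eq_abs, abs_of_pos (exp_pos _), exp_neg,
          inv_mul_le_iff₀ (exp_pos _), mul_comm]
        exact abs_radialSolve_le hM0 hl hb s)
  have hT : ContractingWith (1 / 2) T := by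
    refine ⟨NNReal.half_lt_self one_ne_zero, LipschitzWith.of_dist_le_mul fun w v => ?_⟩
    rw [BoundedContinuousFunction.dist_le (by positivity)]
    intro s
    have hb : ∀ t, |H w t - H v t| ≤ (L * dist w v) * exp (l * t ^ 2) := by
      intro t
      have h1 := hg.dist_le_mul (γ - exp (l * t ^ 2) * w t) (γ - exp (l * t ^ 2) * v t)
      have h2 := BoundedContinuousFunction.dist_coe_le_dist (f := w) (g := v) t
      rw [Real.dist_eq] at h2
      rw [Real.dist_eq, Real.dist_eq] at h1
      have h3 : γ - exp (l * t ^ 2) * w t - (γ - exp (l * t ^ 2) * v t)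
          = -(exp (l * t ^ 2) * (w t - v t)) := by ring
      rw [h3, abs_neg, abs_mul, abs_of_pos (exp_pos _)] at h1
      calc _ ≤ L * (exp (l * t ^ 2) * |w t - v t|) := h1
        _ ≤ L * (exp (l * t ^ 2) * dist w v) := by gcongr
        _ = _ := by ring
    have h4 := abs_radialSolve_le (n := n) (by positivity) hl hb s
    rw [radialSolve_sub (hH w) (hH v)] at h4
    change dist (exp (-(l * s ^ 2)) * radialSolve n (H w) s)
      (exp (-(l * s ^ 2)) * radialSolve n (H v) s) ≤ _
    rw [Real.dist_eq, ← mul_sub, abs_mul, abs_of_pos (exp_pos _), exp_neg,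
      inv_mul_le_iff₀ (exp_pos _), mul_comm]
    refine h4.trans (mul_le_mul_of_nonneg_right ?_ (exp_pos _).le)
    rw [div_le_iff₀ (by positivity)]
    push_cast
    nlinarith [dist_nonneg (x := w) (y := v)]
  obtain ⟨w, hw⟩ : ∃ w, T w = w := ⟨_, hT.fixedPoint_isFixedPt⟩
  have hfix : ∀ s, exp (l * s ^ 2) * w s = radialSolve n (H w) s := by
    intro s
    have : exp (-(l * s ^ 2)) * radialSolve n (H w) s = w s :=
      congrArg (fun f : BoundedContinuousFunction ℝ ℝ => f s) hw
    rw [← this, ← mul_assoc, ← exp_add]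
    simp
  have hHw : ∀ s, H w s = g (γ - radialSolve n (H w) s) := fun s => by rw [← hfix]
  refine ⟨fun s => γ - radialSolve n (H w) s, fun s => -(s * radialAverage n (H w) s),
    fun s => -(H w s - n * radialAverage n (H w) s),
    fun s => (hasDerivAt_radialSolve (hH w) s).const_sub γ,
    fun s => (hasDerivAt_mul_radialAverage (hH w) s).neg, ?_, ?_, ?_, ?_⟩
  · have := continuous_radialAverage (n := n) (hH w)
    have := hH w
    fun_prop
  · simp [radialSolve]
  · simp
  · intro s hs
    simp only [← hHw]
    field_simp
    ring

lemma exists_first_zero {f : ℝ → ℝ} (hf : Continuous f) {a c : ℝ} (hac : a ≤ c) (ha : 0 < f a)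
    (hc : f c ≤ 0) : ∃ b ∈ Ioc a c, f b = 0 ∧ ∀ s ∈ Ico a b, 0 < f s := by
  have hK : IsCompact (Icc a c ∩ {s | f s ≤ 0}) :=
    isCompact_Icc.inter_right (isClosed_le hf continuous_const)
  obtain ⟨b, ⟨hb, hfb⟩, hmin⟩ := hK.exists_isLeast ⟨c, ⟨hac, le_rfl⟩, hc⟩
  have hfb : f b ≤ 0 := hfb
  obtain ⟨x, hx, hfx⟩ := intermediate_value_Icc' hb.1 hf.continuousOn ⟨hfb, ha.le⟩
  have hxb : b = x := le_antisymm (hmin ⟨⟨hx.1, hx.2.trans hb.2⟩, hfx.le⟩) hx.2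
  refine ⟨b, ⟨lt_of_le_of_ne hb.1 ?_, hb.2⟩, hxb ▸ hfx, fun s hs => ?_⟩
  · rintro rfl
    exact absurd ha hfb.not_gt
  · by_contra! h
    exact absurd (hmin ⟨⟨hs.1, hs.2.le.trans hb.2⟩, h⟩) hs.2.not_ge

/-- A radial ODE `v'' + (n/s) v' + c(s) v = 0` with `c` bounded below by a positive constant has
no solution without zeros near infinity. -/
theorem not_nonoscillating {n : ℕ} {v v' v'' : ℝ → ℝ} {S c : ℝ} (hc : 0 < c)
    (hv : ∀ s > S, HasDerivAt v (v' s) s) (hv' : ∀ s > S, HasDerivAt v' (v'' s) s)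
    (hne : ∀ s > S, v s ≠ 0)
    (hode : ∀ s > S, 0 < s → v s * (v'' s + n / s * v' s) ≤ -(c * v s ^ 2)) : False := by
  obtain ⟨S₀, hS₀S, hS₀1, hS₀n⟩ : ∃ S₀, S < S₀ ∧ 1 ≤ S₀ ∧ (n:ℝ) ^ 2 / c ≤ S₀ :=
    ⟨max (S + 1) (max 1 (n ^ 2 / c)), lt_max_of_lt_left (by linarith),
      (le_max_left _ _).trans (le_max_right _ _), (le_max_right _ _).trans (le_max_right _ _)⟩
  set k : ℝ := min c 1 / 2 with hk_def
  have hk : 0 < k := by have := lt_min hc one_pos; positivity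
  have hkc : 2 * k ≤ c := by have := min_le_left c 1; linarith
  have hk1 : 2 * k ≤ 1 := by have := min_le_right c 1; linarith
  have hder : ∀ s ≥ S₀, HasDerivAt (fun s => arctan (v' s / v s) + k * s)
      ((v'' s * v s - v' s * v' s) / (v s ^ 2 + v' s ^ 2) + k) s := by
    intro s hs
    have hsS : s > S := hS₀S.trans_le hs
    have hvs := hne s hsS
    have h := (((hv' s hsS).div (hv s hsS) hvs).arctan).add ((hasDerivAt_id s).const_mul k)
    refine h.congr_deriv ?_
    have : v s ^ 2 + v' s ^ 2 ≠ 0 := by positivity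
    simp only [Pi.div_apply]
    field_simp
  have hanti : AntitoneOn (fun s => arctan (v' s / v s) + k * s) (Ici S₀) := by
    apply antitoneOn_of_deriv_nonpos (convex_Ici _)
    · exact fun s hs => (hder s hs).continuousAt.continuousWithinAt
    · intro s hs
      rw [interior_Ici] at hs
      exact (hder s hs.le).differentiableAt.differentiableWithinAt
    · intro s hs
      rw [interior_Ici] at hs
      have hs' : S₀ < s := hs
      have hs0 : 0 < s := by linarith
      have hsS : s > S := hS₀S.trans hs
      have hvs := hne s hsS
      rw [(hder s hs.le).deriv]
      have hpos : 0 < v s ^ 2 + v' s ^ 2 := by positivity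
      have ho := hode s hsS hs0
      have hr : ((n:ℝ) / s) ^ 2 ≤ c := by
        rw [div_pow, div_le_iff₀ (by positivity)]
        have h1 : (n:ℝ) ^ 2 ≤ S₀ * c := (div_le_iff₀ hc).1 hS₀n
        nlinarith [mul_le_mul_of_nonneg_left (show S₀ ≤ s ^ 2 by nlinarith) hc.le]
      have hq : -((n:ℝ) / s * v s * v' s) ≤ c * v s ^ 2 / 2 + v' s ^ 2 / 2 := by
        nlinarith [sq_nonneg ((n:ℝ) / s * v s + v' s),
          mul_le_mul_of_nonneg_right hr (sq_nonneg (v s))]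
      have : (v'' s * v s - v' s * v' s) / (v s ^ 2 + v' s ^ 2) ≤ -k := by
        rw [div_le_iff₀ hpos]
        nlinarith [mul_le_mul_of_nonneg_right hkc (sq_nonneg (v s)),
          mul_le_mul_of_nonneg_right hk1 (sq_nonneg (v' s))]
      linarith
  have hπ : 0 ≤ π / k := by positivity
  have h := hanti (mem_Ici.2 le_rfl) (mem_Ici.2 (by linarith : S₀ ≤ S₀ + π / k)) (by linarith)
  have hkπ : k * (π / k) = π := by field_simp
  simp only [mul_add, hkπ] at h
  linarith [arctan_lt_pi_div_two (v' S₀ / v S₀),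
    neg_pi_div_two_lt_arctan (v' (S₀ + π / k) / v (S₀ + π / k))]

lemma fNL_ge_of_one_lt {p u : ℝ} (hp : 1 < p) (hu : 1 ≤ u) : (p - 1) * (u - 1) ≤ fNL p u := by
  have h := one_add_mul_self_le_rpow_one_add (s := u - 1) (by linarith) hp.le
  rw [add_sub_cancel] at h
  unfold fNL
  linarith

lemma rpow_eq_mul_rpow_sub_one {u : ℝ} (hu : 0 < u) (p : ℝ) : u ^ p = u * u ^ (p - 1) := by
  rw [rpow_sub_one hu.ne']
  field_simp

lemma fNL_le_of_lt_one {p u δ : ℝ} (hp : 1 < p) (hδ : 0 < δ) (hu : δ ≤ u) (hu1 : u ≤ 1) :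
    fNL p u ≤ -(δ * ((p - 1) / p) * (1 - u)) := by
  have hu0 : 0 < u := hδ.trans_le hu
  have h1 : u ^ (p - 1) ≤ 1 - (p - 1) / p * (1 - u) := by
    have h2 : u ^ (p - 1) * (1 + (p - 1) * (1 - u)) ≤ 1 := by
      have h3 : u ^ (p - 1) ≤ exp (-((p - 1) * (1 - u))) := by
        rw [rpow_def_of_pos hu0]
        apply exp_le_exp.2
        nlinarith [log_le_sub_one_of_pos hu0]
      calc _ ≤ exp (-((p - 1) * (1 - u))) * exp ((p - 1) * (1 - u)) := by
            gcongr
            linarith [add_one_le_exp ((p - 1) * (1 - u))]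
        _ = 1 := by rw [← exp_add]; simp
    have hd : 0 ≤ (p - 1) * (1 - u) := mul_nonneg (by linarith) (by linarith)
    have h4 : 1 ≤ (1 - (p - 1) / p * (1 - u)) * (1 + (p - 1) * (1 - u)) := by
      have : (1 - (p - 1) / p * (1 - u)) * (1 + (p - 1) * (1 - u))
        = 1 + (p - 1) ^ 2 * (1 - u) * u / p := by field_simp; ring
      rw [this]
      have : 0 ≤ (p - 1) ^ 2 * (1 - u) * u / p := by
        have : 0 ≤ 1 - u := by linarith
        positivity
      linarith
    exact le_of_mul_le_mul_right (h2.trans h4) (by linarith)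
  have h5 : 0 ≤ (p - 1) / p * (1 - u) :=
    mul_nonneg (div_nonneg (by linarith) (by linarith)) (by linarith)
  unfold fNL
  rw [rpow_eq_mul_rpow_sub_one hu0 p]
  nlinarith [mul_le_mul_of_nonneg_left h1 hu0.le, mul_le_mul_of_nonneg_right hu h5]

lemma fNL_neg {p u : ℝ} (hp : 1 < p) (hu : 0 < u) (hu1 : u < 1) : fNL p u < 0 := by
  have := fNL_le_of_lt_one hp hu le_rfl hu1.le
  have h : 0 < u * ((p - 1) / p) * (1 - u) :=
    mul_pos (mul_pos hu (div_pos (by linarith) (by linarith))) (by linarith)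
  linarith

lemma fNL_pos {p u : ℝ} (hp : 1 < p) (hu : 1 < u) : 0 < fNL p u :=
  (mul_pos (sub_pos.2 hp) (sub_pos.2 hu)).trans_le (fNL_ge_of_one_lt hp hu.le)

/-- The nonlinearity `fNL p`, made constant to the left of `0` and to the right of `γ`. -/
def truncNL (p γ u : ℝ) : ℝ := fNL p (max 0 (min u γ))

lemma truncNL_eq {p γ u : ℝ} (h0 : 0 ≤ u) (hγ : u ≤ γ) : truncNL p γ u = fNL p u := by
  rw [truncNL, min_eq_left hγ, max_eq_right h0]

lemma exists_lipschitzWith_truncNL {p γ : ℝ} (hp : 1 < p) (hγ : 0 ≤ γ) :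
    ∃ L, LipschitzWith L (truncNL p γ) := by
  have hbd : ∀ x ∈ Icc 0 γ, ‖-1 + p * x ^ (p - 1)‖ ≤ ((1 + p * γ ^ (p - 1)).toNNReal : ℝ) := by
    intro x hx
    have h1 : x ^ (p - 1) ≤ γ ^ (p - 1) := rpow_le_rpow hx.1 hx.2 (by linarith)
    have h2 : 0 ≤ x ^ (p - 1) := rpow_nonneg hx.1 _
    have h3 : p * x ^ (p - 1) ≤ p * γ ^ (p - 1) := by gcongr
    have h4 : 0 ≤ p * x ^ (p - 1) := by positivity
    rw [Real.coe_toNNReal _ (by linarith), Real.norm_eq_abs, abs_le]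
    constructor <;> linarith
  have hL : LipschitzOnWith (1 + p * γ ^ (p - 1)).toNNReal (fNL p) (Icc 0 γ) := by
    apply (convex_Icc 0 γ).lipschitzOnWith_of_nnnorm_hasDerivWithin_le
      (f' := fun x => -1 + p * x ^ (p - 1)) _ hbd
    intro x _
    exact ((hasDerivAt_id x).neg.add (hasDerivAt_rpow_const (Or.inr hp.le))).hasDerivWithinAt
  refine ⟨(1 + p * γ ^ (p - 1)).toNNReal, LipschitzWith.of_dist_le_mul fun x y => ?_⟩
  have hc : ∀ x, max 0 (min x γ) ∈ Icc 0 γ := fun x =>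
    ⟨le_max_left _ _, max_le hγ (min_le_right _ _)⟩
  refine (hL.dist_le_mul _ (hc x) _ (hc y)).trans ?_
  gcongr
  rw [Real.dist_eq, Real.dist_eq]
  refine (abs_max_sub_max_le_max _ _ _ _).trans ?_
  rw [sub_self, abs_zero, max_eq_right (abs_nonneg _)]
  refine (abs_min_sub_min_le_max _ _ _ _).trans ?_
  rw [sub_self, abs_zero, max_eq_left (abs_nonneg _)]

lemma exists_bound_truncNL {p γ : ℝ} (hp : 1 < p) (hγ : 0 ≤ γ) :
    ∃ M, ∀ x, |truncNL p γ x| ≤ M := by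
  refine ⟨γ + γ ^ p, fun x => ?_⟩
  have h0 : 0 ≤ max 0 (min x γ) := le_max_left _ _
  have h1 : max 0 (min x γ) ≤ γ := max_le hγ (min_le_right _ _)
  have h2 := rpow_le_rpow h0 h1 (by linarith : 0 ≤ p)
  have h3 := rpow_nonneg h0 p
  rw [truncNL, fNL, abs_le]
  constructor <;> linarith

/-- `u` is a C² function on `ℝ` whose restriction to `[0, ∞)` solves
`u'' + (n/s) u' + g(u) = 0`, `u(0) = γ`, `u'(0) = 0`. -/
structure RadialSolution (n : ℕ) (g : ℝ → ℝ) (γ : ℝ) (u u' u'' : ℝ → ℝ) : Prop where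
  deriv₁ : ∀ s, HasDerivAt u (u' s) s
  deriv₂ : ∀ s, HasDerivAt u' (u'' s) s
  continuous₂ : Continuous u''
  apply_zero : u 0 = γ
  deriv_zero : u' 0 = 0
  ode : ∀ s > 0, u'' s + n / s * u' s + g (u s) = 0

namespace RadialSolution

variable {n : ℕ} {g : ℝ → ℝ} {p γ : ℝ} {u u' u'' : ℝ → ℝ}

lemma continuous₀ (R : RadialSolution n g γ u u' u'') : Continuous u :=
  continuous_iff_continuousAt.2 fun s => (R.deriv₁ s).continuousAt

lemma continuous₁ (R : RadialSolution n g γ u u' u'') : Continuous u' :=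
  continuous_iff_continuousAt.2 fun s => (R.deriv₂ s).continuousAt

lemma hasDerivAt_pow_mul (R : RadialSolution n g γ u u' u'') {s : ℝ} (hs : 0 < s) :
    HasDerivAt (fun s => s ^ n * u' s) (-(s ^ n * g (u s))) s := by
  refine ((hasDerivAt_pow n s).mul (R.deriv₂ s)).congr_deriv ?_
  have h := R.ode s hs
  have h1 : u'' s = -(n / s * u' s) - g (u s) := by linarith
  rw [h1]
  rcases n with _ | n
  · simp
  · simp only [Nat.add_sub_cancel]
    field_simp
    ring

lemma hasDerivAt_energy (R : RadialSolution n g γ u u' u'') {H : ℝ → ℝ} {s : ℝ} (hs : 0 < s)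
    (hH : HasDerivAt H (g (u s)) (u s)) :
    HasDerivAt (fun s => u' s ^ 2 / 2 + H (u s)) (-(n / s * u' s ^ 2)) s := by
  refine ((((R.deriv₂ s).pow 2).div_const 2).add (hH.comp s (R.deriv₁ s))).congr_deriv ?_
  have h1 : u'' s = -(n / s * u' s) - g (u s) := by linarith [R.ode s hs]
  rw [h1]
  simp
  ring

lemma energy_antitoneOn (R : RadialSolution n g γ u u' u'') {H : ℝ → ℝ}
    (hH : ∀ s ≥ 0, HasDerivAt H (g (u s)) (u s)) :
    AntitoneOn (fun s => u' s ^ 2 / 2 + H (u s)) (Ici 0) := by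
  apply antitoneOn_of_deriv_nonpos (convex_Ici _)
  · intro s hs
    exact ((((R.continuous₁.continuousAt (x := s)).pow 2).div_const 2).add
      ((hH s hs).comp s (R.deriv₁ s)).continuousAt).continuousWithinAt
  · intro s hs
    rw [interior_Ici] at hs
    exact (R.hasDerivAt_energy hs (hH s (le_of_lt hs))).differentiableAt.differentiableWithinAt
  · intro s hs
    rw [interior_Ici] at hs
    rw [(R.hasDerivAt_energy hs (hH s (le_of_lt hs))).deriv]
    have : 0 < s := hs
    exact neg_nonpos.2 (by positivity)

lemma integral_nonpos_of_deriv_eq_zero (R : RadialSolution n g γ u u' u'') (hg : Continuous g)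
    {s t : ℝ} (hs : 0 ≤ s) (hst : s ≤ t) (hus : u' s = 0) : ∫ x in u s..u t, g x ≤ 0 := by
  have h := R.energy_antitoneOn (H := fun y => ∫ x in u s..y, g x)
    (fun r _ => hg.integral_hasStrictDerivAt _ _ |>.hasDerivAt) hs (hs.trans hst) hst
  simp only [hus, intervalIntegral.integral_same] at h
  nlinarith [sq_nonneg (u' t)]

lemma le_of_pos_above (R : RadialSolution n g γ u u' u'') (hg : Continuous g)
    (hpos : ∀ x ≥ γ, 0 < g x) {s : ℝ} (hs : 0 ≤ s) : u s ≤ γ := by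
  by_contra! h
  have h1 := R.integral_nonpos_of_deriv_eq_zero hg le_rfl hs R.deriv_zero
  rw [R.apply_zero] at h1
  exact h1.not_gt (intervalIntegral.intervalIntegral_pos_of_pos_on (hg.intervalIntegrable _ _)
    (fun x hx => hpos x hx.1.le) h)

lemma ge_of_neg_below (R : RadialSolution n g γ u u' u'') (hg : Continuous g) {s t : ℝ}
    (hs : 0 ≤ s) (hst : s ≤ t) (hus : u' s = 0) (hneg : ∀ x ∈ Ioo (u t) (u s), g x < 0) :
    u s ≤ u t := by
  by_contra! h
  have h1 := R.integral_nonpos_of_deriv_eq_zero hg hs hst hus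
  rw [intervalIntegral.integral_symm, ← intervalIntegral.integral_neg] at h1
  exact h1.not_gt (intervalIntegral.intervalIntegral_pos_of_pos_on
    (hg.neg.intervalIntegrable _ _) (fun x hx => neg_pos.2 (hneg x hx)) h)

lemma deriv_neg_of_pos (R : RadialSolution n g γ u u' u'') (hn : n ≠ 0) {b : ℝ}
    (hpos : ∀ s ∈ Ioo 0 b, 0 < g (u s)) {s : ℝ} (hs : s ∈ Ioc 0 b) : u' s < 0 := by
  have hanti : StrictAntiOn (fun s => s ^ n * u' s) (Icc 0 b) := by
    apply strictAntiOn_of_deriv_neg (convex_Icc _ _)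
    · have := R.continuous₁
      fun_prop
    · intro t ht
      rw [interior_Icc] at ht
      rw [(R.hasDerivAt_pow_mul ht.1).deriv]
      exact neg_neg_of_pos (mul_pos (pow_pos ht.1 n) (hpos t ht))
  have h := hanti ⟨le_rfl, hs.1.le.trans hs.2⟩ ⟨hs.1.le, hs.2⟩ hs.1
  simp only [zero_pow hn, zero_mul] at h
  by_contra! hus
  exact h.not_ge (mul_nonneg (pow_nonneg hs.1.le n) hus)

end RadialSolution

/-- The primitive of `fNL p` on `[0, ∞)` that vanishes at `0`. -/
def fNLPrimitive (p u : ℝ) : ℝ := -(u ^ 2 / 2) + u ^ (p + 1) / (p + 1)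

lemma hasDerivAt_fNLPrimitive {p : ℝ} (hp : 1 < p) (u : ℝ) :
    HasDerivAt (fNLPrimitive p) (fNL p u) u := by
  have h := ((hasDerivAt_pow 2 u).div_const 2).neg.add
    ((hasDerivAt_rpow_const (x := u) (p := p + 1) (Or.inr (by linarith))).div_const (p + 1))
  refine h.congr_deriv ?_
  have : p + 1 ≠ 0 := by linarith
  rw [fNL, add_sub_cancel_right]
  field_simp
  push_cast
  ring

/-- The Pohozaev functional. -/
def pohozaev (n : ℕ) (p : ℝ) (u u' : ℝ → ℝ) (s : ℝ) : ℝ :=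
  s ^ (n + 1) * (u' s ^ 2 / 2 + fNLPrimitive p (u s)) + (n - 1) / 2 * (u s * (s ^ n * u' s))

namespace RadialSolution

variable {n : ℕ} {g : ℝ → ℝ} {p γ : ℝ} {u u' u'' : ℝ → ℝ}

lemma pohozaev_strictAntiOn (R : RadialSolution n g γ u u' u'') (hp : 1 < p)
    (hnp : ((n:ℝ) + 1) / (p + 1) ≤ (n - 1) / 2) {I : Set ℝ} (hI : Convex ℝ I)
    (hI0 : interior I ⊆ Ioi 0)
    (hpos : ∀ s ∈ interior I, 0 < u s) (hg : ∀ s ∈ interior I, g (u s) = fNL p (u s)) :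
    StrictAntiOn (pohozaev n p u u') I := by
  apply strictAntiOn_of_deriv_neg hI
  · have h1 := R.continuous₁
    have h0 := R.continuous₀
    have h2 : Continuous (fNLPrimitive p) :=
      continuous_iff_continuousAt.2 fun x => (hasDerivAt_fNLPrimitive hp x).continuousAt
    unfold pohozaev
    fun_prop
  · intro s hs
    have hs0 : 0 < s := hI0 hs
    have hus := hpos s hs
    have hgs := hg s hs
    have hF : HasDerivAt (fNLPrimitive p) (g (u s)) (u s) :=
      hgs ▸ hasDerivAt_fNLPrimitive hp (u s)
    have hd := ((hasDerivAt_pow (n + 1) s).mul (R.hasDerivAt_energy hs0 hF)).add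
      (((R.deriv₁ s).mul (R.hasDerivAt_pow_mul hs0)).const_mul (((n:ℝ) - 1) / 2))
    have hd' : HasDerivAt (pohozaev n p u u') _ s := hd
    rw [hd'.deriv, hgs, fNL, fNLPrimitive]
    have hpw : u s ^ (p + 1) = u s * u s ^ p := by rw [rpow_add_one hus.ne', mul_comm]
    rw [hpw]
    have key : ((n + 1 : ℕ) : ℝ) * s ^ (n + 1 - 1) *
          (u' s ^ 2 / 2 + (-(u s ^ 2 / 2) + u s * u s ^ p / (p + 1))) +
          s ^ (n + 1) * -(n / s * u' s ^ 2) +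
          ((n:ℝ) - 1) / 2 * (u' s * (s ^ n * u' s) + u s * -(s ^ n * (-u s + u s ^ p)))
        = s ^ n * (-(u s ^ 2) + (((n:ℝ) + 1) / (p + 1) - (n - 1) / 2) * (u s * u s ^ p)) := by
      have : p + 1 ≠ 0 := by linarith
      simp only [Nat.add_sub_cancel]
      push_cast
      field_simp
      ring
    rw [key]
    refine mul_neg_of_pos_of_neg (pow_pos hs0 n) ?_
    have h1 : 0 < u s * u s ^ p := mul_pos hus (rpow_pos_of_pos hus p)
    nlinarith [mul_nonneg (sub_nonneg.2 hnp) h1.le, sq_pos_of_pos hus]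

lemma pohozaev_zero (R : RadialSolution n g γ u u' u'') : pohozaev n p u u' 0 = 0 := by
  simp [pohozaev, R.deriv_zero]

lemma pos_of_supercritical (R : RadialSolution n g γ u u' u'') (hp : 1 < p)
    (hnp : ((n:ℝ) + 1) / (p + 1) ≤ (n - 1) / 2) (hγ : 0 < γ)
    (hg : ∀ s ≥ 0, 0 < u s → g (u s) = fNL p (u s)) {s : ℝ} (hs : 0 ≤ s) : 0 < u s := by
  by_contra! h
  obtain ⟨b, hb, hub, hpos⟩ :=
    exists_first_zero R.continuous₀ hs (by rwa [R.apply_zero]) h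
  have hP := R.pohozaev_strictAntiOn hp hnp (convex_Icc 0 b)
    (by rw [interior_Icc]; exact fun x hx => hx.1)
    (by rw [interior_Icc]; exact fun x hx => hpos x ⟨hx.1.le, hx.2⟩)
    (by rw [interior_Icc]; exact fun x hx => hg x hx.1.le (hpos x ⟨hx.1.le, hx.2⟩))
    ⟨le_rfl, hb.1.le⟩ ⟨hb.1.le, le_rfl⟩ hb.1
  rw [R.pohozaev_zero, pohozaev, hub, fNLPrimitive, zero_rpow (by linarith)] at hP
  have : 0 ≤ b ^ (n + 1) * (u' b ^ 2 / 2) := by have := hb.1.le; positivity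
  norm_num at hP
  linarith

lemma not_one_lt_eventually (R : RadialSolution n (fNL p) γ u u' u'') (hp : 1 < p) {S : ℝ}
    (h : ∀ s > S, 1 < u s) : False := by
  refine not_nonoscillating (n := n) (v := fun s => u s - 1) (S := S) (c := p - 1)
    (sub_pos.2 hp) (fun s _ => (R.deriv₁ s).sub_const 1) (fun s _ => R.deriv₂ s)
    (fun s hs => (sub_pos.2 (h s hs)).ne') fun s hs hs0 => ?_
  have h1 : u'' s + n / s * u' s = -fNL p (u s) := by linarith [R.ode s hs0]
  have h2 := mul_le_mul_of_nonneg_left (fNL_ge_of_one_lt hp (h s hs).le)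
    (sub_pos.2 (h s hs)).le
  rw [h1]
  nlinarith

lemma not_lt_one_eventually (R : RadialSolution n (fNL p) γ u u' u'') (hp : 1 < p) {S δ : ℝ}
    (hδ : 0 < δ) (hδu : ∀ s > S, δ ≤ u s) (h : ∀ s > S, u s < 1) : False := by
  refine not_nonoscillating (n := n) (v := fun s => u s - 1) (S := S) (c := δ * ((p - 1) / p))
    (mul_pos hδ (div_pos (by linarith) (by linarith))) (fun s _ => (R.deriv₁ s).sub_const 1)
    (fun s _ => R.deriv₂ s) (fun s hs => (sub_neg.2 (h s hs)).ne) fun s hs hs0 => ?_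
  have h1 : u'' s + n / s * u' s = -fNL p (u s) := by linarith [R.ode s hs0]
  have h2 := mul_le_mul_of_nonneg_left (fNL_le_of_lt_one hp hδ (hδu s hs) (h s hs).le)
    (sub_pos.2 (h s hs)).le
  rw [h1]
  nlinarith

/-- A solution bounded below by a positive constant takes the value `1` arbitrarily far out. -/
lemma exists_gt_eq_one (R : RadialSolution n (fNL p) γ u u' u'') (hp : 1 < p) {S δ : ℝ}
    (hδ : 0 < δ) (hδu : ∀ s > S, δ ≤ u s) : ∃ s > S, u s = 1 := by
  by_contra! h
  have hc : ContinuousOn u (Ioi S) := R.continuous₀.continuousOn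
  by_cases h1 : ∀ s > S, 1 < u s
  · exact R.not_one_lt_eventually hp h1
  · push Not at h1
    obtain ⟨a, ha, hua⟩ := h1
    refine R.not_lt_one_eventually hp hδ hδu fun s hs => ?_
    by_contra! hus
    obtain ⟨x, hx, hx1⟩ := isPreconnected_Ioi.intermediate_value ha hs hc ⟨hua, hus⟩
    exact h x hx hx1

/-- A decreasing positive solution of the supercritical problem stays away from `0`. -/
lemma exists_pos_le_of_deriv_neg (R : RadialSolution n (fNL p) γ u u' u'') (hp : 1 < p)
    (hn : 1 ≤ n) (hnp : ((n:ℝ) + 1) / (p + 1) ≤ (n - 1) / 2) (hpos : ∀ s ≥ 0, 0 < u s)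
    (hneg : ∀ s > 0, u' s < 0) : ∃ δ > 0, ∀ s ≥ 0, δ ≤ u s := by
  by_contra! hsmall
  have hanti : AntitoneOn u (Ici 0) := by
    apply antitoneOn_of_deriv_nonpos (convex_Ici _) R.continuous₀.continuousOn
    · exact fun s _ => (R.deriv₁ s).differentiableAt.differentiableWithinAt
    · intro s hs
      rw [interior_Ici] at hs
      rw [(R.deriv₁ s).deriv]
      exact (hneg s hs).le
  have hu0 : Tendsto u atTop (𝓝 0) := by
    rw [Metric.tendsto_atTop]
    intro ε hε
    obtain ⟨a, ha, hua⟩ := hsmall ε hε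
    refine ⟨a, fun s hs => ?_⟩
    rw [Real.dist_eq, sub_zero, abs_of_pos (hpos s (ha.trans hs))]
    exact (hanti ha (ha.trans hs : 0 ≤ s) hs).trans_lt hua
  have hE := R.energy_antitoneOn (fun s _ => hasDerivAt_fNLPrimitive hp (u s))
  have hE0 : ∀ s ≥ 0, 0 ≤ u' s ^ 2 / 2 + fNLPrimitive p (u s) := by
    intro s hs
    have hlim : Tendsto (fun t => fNLPrimitive p (u t)) atTop (𝓝 0) := by
      have h0 : fNLPrimitive p 0 = 0 := by
        rw [fNLPrimitive, zero_rpow (by linarith)]; simp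
      exact h0 ▸ ((hasDerivAt_fNLPrimitive hp 0).continuousAt.tendsto.comp hu0)
    refine le_of_tendsto hlim ?_
    filter_upwards [eventually_ge_atTop s] with t ht
    have := hE hs (hs.trans ht : (0:ℝ) ≤ t) ht
    simp only at this
    nlinarith [sq_nonneg (u' t)]
  obtain ⟨B, hB⟩ : ∃ B, ∀ s ≥ 0, -u' s ≤ B := by
    refine ⟨2 * (u' 0 ^ 2 / 2 + fNLPrimitive p (u 0)) + γ ^ 2 + 1, fun s hs => ?_⟩
    have h1 := hE (mem_Ici.2 le_rfl) hs hs
    simp only at h1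
    have h2 : -(γ ^ 2 / 2) ≤ fNLPrimitive p (u s) := by
      have h3 : u s ≤ γ := R.apply_zero ▸ hanti (mem_Ici.2 le_rfl) hs hs
      have h4 : 0 ≤ u s ^ (p + 1) / (p + 1) :=
        div_nonneg (rpow_nonneg (hpos s hs).le _) (by linarith)
      rw [fNLPrimitive]
      nlinarith [hpos s hs]
    nlinarith [sq_nonneg (u' s + 1)]
  have hdecay : ∀ᶠ s in atTop, u s / 2 ≤ -u' s := by
    have hq : Tendsto (fun s => u s ^ (p - 1)) atTop (𝓝 0) := by
      have := hu0.rpow_const (p := p - 1) (Or.inr (by linarith))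
      rwa [zero_rpow (by linarith)] at this
    filter_upwards [hq.eventually_lt_const (show (0:ℝ) < 3 / 4 by norm_num),
      eventually_gt_atTop 0] with s hs hs0
    have hus := hpos s hs0.le
    have h1 := hE0 s hs0.le
    have h2 : u s ^ (p + 1) = u s ^ 2 * u s ^ (p - 1) := by
      rw [← rpow_natCast, ← rpow_add hus]
      congr 1
      push_cast
      ring
    have h3 : u s ^ (p + 1) / (p + 1) ≤ u s ^ 2 * (3 / 8) := by
      rw [h2, div_le_iff₀ (by linarith)]
      nlinarith [mul_le_mul_of_nonneg_left hs.le (sq_nonneg (u s)), sq_nonneg (u s)]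
    rw [fNLPrimitive] at h1
    have h4 : (u s / 2) ^ 2 ≤ (-u' s) ^ 2 := by nlinarith
    exact abs_le_of_sq_le_sq' h4 (neg_nonneg.2 (hneg s hs0).le) |>.2
  obtain ⟨S, hS⟩ := eventually_atTop.1 hdecay
  have hexp : AntitoneOn (fun s => u s * exp (s / 2)) (Ici S) := by
    have hd : ∀ s, HasDerivAt (fun s => u s * exp (s / 2))
        ((u' s + u s / 2) * exp (s / 2)) s := fun s =>
      ((R.deriv₁ s).mul ((hasDerivAt_id s).div_const 2).exp).congr_deriv (by simp; ring)
    apply antitoneOn_of_deriv_nonpos (convex_Ici _)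
    · exact fun s _ => (hd s).continuousAt.continuousWithinAt
    · exact fun s _ => (hd s).differentiableAt.differentiableWithinAt
    · intro s hs
      rw [interior_Ici] at hs
      rw [(hd s).deriv]
      exact mul_nonpos_of_nonpos_of_nonneg (by linarith [hS s (le_of_lt hs)]) (exp_pos _).le
  have hlim : Tendsto (fun s => s ^ n * u s) atTop (𝓝 0) := by
    have h1 : Tendsto (fun s : ℝ => u S * exp (S / 2) * 2 ^ n * ((s / 2) ^ n * exp (-(s / 2))))
        atTop (𝓝 0) := by
      have := ((tendsto_pow_mul_exp_neg_atTop_nhds_zero n).comp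
        (tendsto_id.atTop_div_const (show (0:ℝ) < 2 by norm_num))).const_mul
        (u S * exp (S / 2) * 2 ^ n)
      rwa [mul_zero] at this
    refine tendsto_of_tendsto_of_tendsto_of_le_of_le' tendsto_const_nhds h1 ?_ ?_
    · filter_upwards [eventually_ge_atTop 0] with s hs
      exact mul_nonneg (pow_nonneg hs n) (hpos s hs).le
    · filter_upwards [eventually_ge_atTop 0, eventually_ge_atTop S] with s hs hsS
      have h2 := hexp (mem_Ici.2 le_rfl) (mem_Ici.2 hsS) hsS
      simp only at h2
      have h3 : u s ≤ u S * exp (S / 2) * exp (-(s / 2)) := by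
        rwa [exp_neg, ← div_eq_mul_inv, le_div_iff₀ (exp_pos _)]
      calc s ^ n * u s ≤ s ^ n * (u S * exp (S / 2) * exp (-(s / 2))) := by gcongr
        _ = _ := by rw [div_pow]; field_simp
  have hP := R.pohozaev_strictAntiOn hp hnp (convex_Ici 0) (by rw [interior_Ici])
    (by rw [interior_Ici]; exact fun s hs => hpos s (le_of_lt hs)) (fun s _ => rfl)
  have hP1 : pohozaev n p u u' 1 < 0 := by
    have := hP (mem_Ici.2 le_rfl) (mem_Ici.2 zero_le_one) one_pos
    rwa [R.pohozaev_zero] at this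
  have hlim' : Tendsto (fun s => -(((n:ℝ) - 1) / 2 * B * (s ^ n * u s))) atTop (𝓝 0) := by
    have := (hlim.const_mul (((n:ℝ) - 1) / 2 * B)).neg
    rwa [mul_zero, neg_zero] at this
  refine hP1.not_ge (le_of_tendsto hlim' ?_)
  filter_upwards [eventually_ge_atTop 1] with s hs
  have hs0 : 0 ≤ s := by linarith
  have h1 : pohozaev n p u u' s ≤ pohozaev n p u u' 1 :=
    hP.antitoneOn (mem_Ici.2 zero_le_one) (mem_Ici.2 hs0) hs
  have h2 : 0 ≤ s ^ (n + 1) * (u' s ^ 2 / 2 + fNLPrimitive p (u s)) :=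
    mul_nonneg (pow_nonneg hs0 _) (hE0 s hs0)
  have hn1 : 0 ≤ ((n:ℝ) - 1) / 2 := by
    have : (1:ℝ) ≤ n := by exact_mod_cast hn
    linarith
  have h3 : ((n:ℝ) - 1) / 2 * (s ^ n * u s) * (-u' s) ≤ ((n:ℝ) - 1) / 2 * (s ^ n * u s) * B :=
    mul_le_mul_of_nonneg_left (hB s hs0)
      (mul_nonneg hn1 (mul_nonneg (pow_nonneg hs0 n) (hpos s hs0).le))
  refine le_trans ?_ h1
  rw [pohozaev]
  linarith

lemma exists_first_min (R : RadialSolution n (fNL p) γ u u' u'') (hp : 1 < p)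
    (hn : 1 ≤ n) (hnp : ((n:ℝ) + 1) / (p + 1) ≤ (n - 1) / 2) (hγ : 1 < γ)
    (hpos : ∀ s ≥ 0, 0 < u s) :
    ∃ s₁ > 0, u' s₁ = 0 ∧ (∀ s ∈ Ioo 0 s₁, u' s < 0) ∧ u s₁ < 1 := by
  obtain ⟨c, hc0, hc⟩ : ∃ c > 0, u c ≤ 1 := by
    by_contra! h
    exact R.not_one_lt_eventually hp h
  obtain ⟨a, ha, hua, hu1⟩ := exists_first_zero (f := fun s => u s - 1)
    (R.continuous₀.sub continuous_const) hc0.le (by simp [R.apply_zero, hγ]) (by simpa using hc)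
  have hneg : ∀ s ∈ Ioc 0 a, u' s < 0 := fun s hs =>
    R.deriv_neg_of_pos (by omega) (fun t ht => fNL_pos hp (sub_pos.1 (hu1 t ⟨ht.1.le, ht.2⟩))) hs
  obtain ⟨d, hd, hud⟩ : ∃ d > a, 0 ≤ u' d := by
    by_contra! h
    have hneg' : ∀ s > 0, u' s < 0 := fun s hs =>
      (le_or_gt s a).elim (fun hsa => hneg s ⟨hs, hsa⟩) (h s)
    obtain ⟨δ, hδ, hδu⟩ := R.exists_pos_le_of_deriv_neg hp hn hnp hpos hneg'
    refine R.not_lt_one_eventually hp (S := a) hδ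
      (fun s hs => hδu s (ha.1.le.trans (le_of_lt hs))) fun s hs => ?_
    have hsa : StrictAntiOn u (Ici a) := by
      apply strictAntiOn_of_deriv_neg (convex_Ici _) R.continuous₀.continuousOn
      intro t ht
      rw [interior_Ici] at ht
      rw [(R.deriv₁ t).deriv]
      exact h t ht
    have := hsa (mem_Ici.2 le_rfl) (mem_Ici.2 (le_of_lt hs)) hs
    linarith
  obtain ⟨s₁, hs₁, hus₁, hlt⟩ := exists_first_zero (f := fun s => -u' s) R.continuous₁.neg
    hd.le (neg_pos.2 (hneg a ⟨ha.1, le_rfl⟩)) (neg_nonpos.2 hud)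
  refine ⟨s₁, ha.1.trans hs₁.1, neg_eq_zero.1 hus₁, fun s hs => ?_, ?_⟩
  · exact (le_or_gt s a).elim (fun hsa => hneg s ⟨hs.1, hsa⟩)
      (fun hsa => neg_pos.1 (hlt s ⟨hsa.le, hs.2⟩))
  · have hsa : StrictAntiOn u (Icc a s₁) := by
      apply strictAntiOn_of_deriv_neg (convex_Icc _ _) R.continuous₀.continuousOn
      intro t ht
      rw [interior_Icc] at ht
      rw [(R.deriv₁ t).deriv]
      exact neg_pos.1 (hlt t ⟨ht.1.le, ht.2⟩)
    have := hsa ⟨le_rfl, hs₁.1.le⟩ ⟨hs₁.1.le, le_rfl⟩ hs₁.1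
    linarith

end RadialSolution

/-- For `p ≥ p_S` and `γ > 1` the initial value problem has a global positive solution. -/
theorem exists_positive_radialSolution {n : ℕ} {p γ : ℝ} (hp : 1 < p)
    (hnp : ((n:ℝ) + 1) / (p + 1) ≤ (n - 1) / 2) (hγ : 1 < γ) :
    ∃ u u' u'' : ℝ → ℝ, RadialSolution n (truncNL p γ) γ u u' u'' ∧
      ∀ s ≥ 0, 0 < u s ∧ u s ≤ γ := by
  have hγ0 : 0 < γ := by linarith
  obtain ⟨L, hL⟩ := exists_lipschitzWith_truncNL hp hγ0.le
  obtain ⟨M, hM⟩ := exists_bound_truncNL hp hγ0.le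
  obtain ⟨u, u', u'', h₁, h₂, hc, h0, h0', hode⟩ := exists_radial_solution n hL hM γ
  have R : RadialSolution n (truncNL p γ) γ u u' u'' := ⟨h₁, h₂, hc, h0, h0', hode⟩
  have hle : ∀ s ≥ 0, u s ≤ γ := fun s hs => R.le_of_pos_above hL.continuous (fun x hx => by
    rw [truncNL, min_eq_right hx, max_eq_right hγ0.le]
    exact fNL_pos hp hγ) hs
  exact ⟨u, u', u'', R, fun s hs => ⟨R.pos_of_supercritical hp hnp hγ0
    (fun t ht hut => truncNL_eq hut.le (hle t ht)) hs, hle s hs⟩⟩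

/-- for `p ≥ p_S` and `γ > 1`, the solution `u(·,γ)` exists and is
positive on `[0,∞)`, has a first positive critical point `s₁` which is a minimum
below `1` bounding `u` from below afterwards, and `u - 1` has infinitely many zeros;
in particular there are infinitely many positive critical points. -/
theorem ivp_solution_oscillates_above_one (N : ℕ) (hN : 3 ≤ N) (p : ℝ) (hp : 1 < p)
    (hpS : pSob N ≤ p) (γ : ℝ) (hγ : 1 < γ) :
    ∃ u u' u'' : ℝ → ℝ, IsIVPSol N p γ u u' u'' ∧
      (∀ s ≥ (0:ℝ), 0 < u s) ∧
      (∃ s₁ > (0:ℝ), u' s₁ = 0 ∧ (∀ s ∈ Ioo 0 s₁, u' s < 0) ∧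
        0 < u s₁ ∧ u s₁ < 1 ∧ ∀ s ≥ s₁, u s₁ ≤ u s) ∧
      {s : ℝ | 0 < s ∧ u s = 1}.Infinite ∧
      {s : ℝ | 0 < s ∧ u' s = 0}.Infinite := by
  obtain ⟨n, rfl⟩ : ∃ n, N = n + 1 := ⟨N - 1, by omega⟩
  have hn2 : (2:ℝ) ≤ n := by exact_mod_cast (by omega : 2 ≤ n)
  have hN1 : (((n + 1 : ℕ) : ℝ) - 1) = n := by push_cast; ring
  have hnp : ((n:ℝ) + 1) / (p + 1) ≤ (n - 1) / 2 := by
    rw [pSob, div_le_iff₀ (by push_cast; linarith)] at hpS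
    push_cast at hpS
    rw [div_le_div_iff₀ (by linarith) (by norm_num)]
    nlinarith
  obtain ⟨u, u', u'', R', hu⟩ := exists_positive_radialSolution hp hnp hγ
  have hpos : ∀ s ≥ 0, 0 < u s := fun s hs => (hu s hs).1
  have hcont : Continuous (truncNL p γ) :=
    (exists_lipschitzWith_truncNL hp (by linarith)).choose_spec.continuous
  have R : RadialSolution n (fNL p) γ u u' u'' :=
    { R' with
      ode := fun s hs => by
        rw [← truncNL_eq (hpos s hs.le).le (hu s hs.le).2]
        exact R'.ode s hs }
  obtain ⟨s₁, hs₁, hus₁, hneg, hlt⟩ := R.exists_first_min hp (by omega) hnp hγ hpos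
  have hmin : ∀ s ≥ s₁, u s₁ ≤ u s := by
    intro s hs
    refine R'.ge_of_neg_below hcont hs₁.le hs hus₁ fun x hx => ?_
    have hx0 : 0 < x := (hpos s (hs₁.le.trans hs)).trans hx.1
    rw [truncNL_eq hx0.le (by linarith [hx.2])]
    exact fNL_neg hp hx0 (hx.2.trans hlt)
  have hone : ∀ a, ∃ s > a, 0 < s ∧ u s = 1 := by
    intro a
    obtain ⟨s, hs, hus⟩ := R.exists_gt_eq_one (S := max a s₁) hp (hpos s₁ hs₁.le)
      (fun s hs => hmin s ((le_max_right _ _).trans (le_of_lt hs)))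
    exact ⟨s, (le_max_left _ _).trans_lt hs, hs₁.trans ((le_max_right _ _).trans_lt hs), hus⟩
  refine ⟨u, u', u'', ⟨fun s _ => (R.deriv₁ s).hasDerivWithinAt,
    fun s _ => (R.deriv₂ s).hasDerivWithinAt, R.continuous₂.continuousOn, R.apply_zero,
    R.deriv_zero, fun s hs => by rw [hN1]; exact R.ode s hs⟩, hpos,
    ⟨s₁, hs₁, hus₁, hneg, hpos s₁ hs₁.le, hlt, hmin⟩, ?_, ?_⟩
  · refine Set.infinite_of_forall_exists_gt fun a => ?_
    obtain ⟨s, hs, hs'⟩ := hone a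
    exact ⟨s, hs', hs⟩
  · refine Set.infinite_of_forall_exists_gt fun a => ?_
    obtain ⟨b, hb, hb0, hub⟩ := hone a
    obtain ⟨c, hc, -, huc⟩ := hone b
    obtain ⟨x, hx, hx0⟩ := exists_hasDerivAt_eq_zero hc R.continuous₀.continuousOn
      (hub.trans huc.symm) (fun x _ => R.deriv₁ x)
    exact ⟨x, ⟨hb0.trans hx.1, hx0⟩, hb.trans hx.1⟩
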